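/- arXiv:2209.02659 — 3 statements merged into one kernel-verified Lean document; each statement's English description precedes it below -/
import Mathlib

section
/- Let U ⊆ ℝ² be open, let v : U → ℝ be twice continuously differentiable, and let ψ ∈ C_c^∞(U). Then ∫_U (−det D²v) v² ψ dx = −(3/2) ∫_U (D(|Dv|²) · Dv) v ψ dx − ∫_U |Dv|⁴ ψ dx − ∫_U |Dv|² (Dv · Dψ) v dx + (1/2) ∫_U v² (|Dv|² Δψ − D²ψ Dv · Dv) dx. -/
open Real MeasureTheory
open scoped RealInnerProductSpace

noncomputable section

/-- The Euclidean plane ℝ². -/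
abbrev E2 : Type := EuclideanSpace ℝ (Fin 2)

/-- Standard basis vector. -/
def ee (i : Fin 2) : E2 := EuclideanSpace.single i (1 : ℝ)

/-- Partial derivative ∂ᵢf. -/
def pd (i : Fin 2) (f : E2 → ℝ) (x : E2) : ℝ := fderiv ℝ f x (ee i)

/-- Second partial derivative ∂ᵢ∂ⱼf. -/
def pd2 (i j : Fin 2) (f : E2 → ℝ) (x : E2) : ℝ := pd i (pd j f) x

/-- |Df|², squared Euclidean norm of the gradient. -/
def gradSq (f : E2 → ℝ) (x : E2) : ℝ := (pd 0 f x) ^ 2 + (pd 1 f x) ^ 2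

/-- |Df|, Euclidean norm of the gradient. -/
def gradNorm (f : E2 → ℝ) (x : E2) : ℝ := Real.sqrt (gradSq f x)

/-- Laplacian Δf = tr D²f. -/
def lap (f : E2 → ℝ) (x : E2) : ℝ := pd2 0 0 f x + pd2 1 1 f x

/-- ∞-Laplacian Δ∞f = D²f Df · Df. -/
def infLap (f : E2 → ℝ) (x : E2) : ℝ :=
  pd2 0 0 f x * pd 0 f x * pd 0 f x + pd2 0 1 f x * pd 0 f x * pd 1 f x +
  pd2 1 0 f x * pd 1 f x * pd 0 f x + pd2 1 1 f x * pd 1 f x * pd 1 f x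

/-- |D²f|², squared Frobenius norm of the Hessian. -/
def hessFrobSq (f : E2 → ℝ) (x : E2) : ℝ :=
  (pd2 0 0 f x) ^ 2 + (pd2 0 1 f x) ^ 2 + (pd2 1 0 f x) ^ 2 + (pd2 1 1 f x) ^ 2

/-- det D²f, determinant of the Hessian. -/
def detHess (f : E2 → ℝ) (x : E2) : ℝ :=
  pd2 0 0 f x * pd2 1 1 f x - pd2 0 1 f x * pd2 1 0 f x

/-- |D²f Df|². -/
def hessGradSq (f : E2 → ℝ) (x : E2) : ℝ :=
  (pd2 0 0 f x * pd 0 f x + pd2 0 1 f x * pd 1 f x) ^ 2 +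
  (pd2 1 0 f x * pd 0 f x + pd2 1 1 f x * pd 1 f x) ^ 2

/-- Jacobian determinant of the planar map with components `F 0`, `F 1`. -/
def jdet (F : Fin 2 → E2 → ℝ) (x : E2) : ℝ :=
  pd 0 (F 0) x * pd 1 (F 1) x - pd 1 (F 0) x * pd 0 (F 1) x

/-- Squared Frobenius norm of the Jacobian of the planar map with components `F 0`, `F 1`. -/
def jFrobSq (F : Fin 2 → E2 → ℝ) (x : E2) : ℝ :=
  (pd 0 (F 0) x) ^ 2 + (pd 1 (F 0) x) ^ 2 + (pd 0 (F 1) x) ^ 2 + (pd 1 (F 1) x) ^ 2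

/-- Df · Dg. -/
def gradDot (f g : E2 → ℝ) (x : E2) : ℝ :=
  pd 0 f x * pd 0 g x + pd 1 f x * pd 1 g x

/-- D²ψ Dv · Dv. -/
def hessQuad (ψ v : E2 → ℝ) (x : E2) : ℝ :=
  pd2 0 0 ψ x * pd 0 v x * pd 0 v x + pd2 0 1 ψ x * pd 0 v x * pd 1 v x +
  pd2 1 0 ψ x * pd 1 v x * pd 0 v x + pd2 1 1 ψ x * pd 1 v x * pd 1 v x

/-- (D²v Dv) · Dψ. -/
def hessGradDot (v ψ : E2 → ℝ) (x : E2) : ℝ :=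
  (pd2 0 0 v x * pd 0 v x + pd2 0 1 v x * pd 1 v x) * pd 0 ψ x +
  (pd2 1 0 v x * pd 0 v x + pd2 1 1 v x * pd 1 v x) * pd 1 ψ x

/-- Smooth compactly supported test function on Ω. -/
def IsTestOn (ψ : E2 → ℝ) (Ω : Set E2) : Prop :=
  ContDiff ℝ (⊤ : ℕ∞) ψ ∧ HasCompactSupport ψ ∧ tsupport ψ ⊆ Ω

/-- Components of W = |Dv|⁻¹ Dv. -/
def Wcomp (v : E2 → ℝ) (i : Fin 2) : E2 → ℝ := fun y => (gradNorm v y)⁻¹ * pd i v y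

lemma pd_congr {f g : E2 → ℝ} {x : E2} (h : f =ᶠ[nhds x] g) (i : Fin 2) :
    pd i f x = pd i g x := by
  unfold pd; rw [h.fderiv_eq]

lemma pd_congr_ev {f g : E2 → ℝ} {x : E2} (h : f =ᶠ[nhds x] g) (i : Fin 2) :
    pd i f =ᶠ[nhds x] pd i g := by
  filter_upwards [h.eventuallyEq_nhds] with y hy using pd_congr hy i

lemma pd_zero_of_ev {f : E2 → ℝ} {x : E2} (h : f =ᶠ[nhds x] fun _ => 0) (i : Fin 2) :
    pd i f x = 0 := by
  rw [pd_congr h i]; simp [pd]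

lemma ev_zero_of_notMem {f : E2 → ℝ} {x : E2} (h : x ∉ tsupport f) :
    f =ᶠ[nhds x] fun _ => 0 := notMem_tsupport_iff_eventuallyEq.mp h

lemma pd_ev_zero {f : E2 → ℝ} {x : E2} (h : f =ᶠ[nhds x] fun _ => 0) (i : Fin 2) :
    pd i f =ᶠ[nhds x] fun _ => 0 := by
  filter_upwards [h.eventuallyEq_nhds] with y hy using pd_zero_of_ev hy i

lemma pd_contDiff {f : E2 → ℝ} {n : ℕ∞} (hf : ContDiff ℝ (n + 1) f) (i : Fin 2) :
    ContDiff ℝ n (pd i f) := by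
  unfold pd
  exact (hf.fderiv_right le_rfl).clm_apply contDiff_const

lemma pd_cont {f : E2 → ℝ} (hf : ContDiff ℝ 1 f) (i : Fin 2) : Continuous (pd i f) := by
  unfold pd
  exact (hf.continuous_fderiv one_ne_zero).clm_apply continuous_const

lemma pd_hcs {f : E2 → ℝ} (hf : HasCompactSupport f) (i : Fin 2) :
    HasCompactSupport (pd i f) :=
  HasCompactSupport.intro hf fun _ hx => pd_zero_of_ev (ev_zero_of_notMem hx) i

lemma pd2_symm {f : E2 → ℝ} (hf : ContDiff ℝ 2 f) (x : E2) (i j : Fin 2) :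
    pd2 i j f x = pd2 j i f x := by
  have h := (hf.contDiffAt (x := x)).isSymmSndFDerivAt (by simp)
  have hd : DifferentiableAt ℝ (fderiv ℝ f) x :=
    ((hf.fderiv_right (m := 1) (by norm_num)).differentiable one_ne_zero) x
  have key : ∀ i j : Fin 2, pd2 i j f x = fderiv ℝ (fderiv ℝ f) x (ee i) (ee j) := by
    intro i j
    unfold pd2 pd
    rw [fderiv_clm_apply hd (differentiableAt_const _)]
    simp
  rw [key, key]
  exact h (ee i) (ee j)

lemma pd_add {f g : E2 → ℝ} {x : E2} (hf : DifferentiableAt ℝ f x)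
    (hg : DifferentiableAt ℝ g x) (i : Fin 2) :
    pd i (fun y => f y + g y) x = pd i f x + pd i g x := by
  unfold pd; rw [fderiv_fun_add hf hg]; rfl

lemma pd_mul {f g : E2 → ℝ} {x : E2} (hf : DifferentiableAt ℝ f x)
    (hg : DifferentiableAt ℝ g x) (i : Fin 2) :
    pd i (fun y => f y * g y) x = f x * pd i g x + g x * pd i f x := by
  unfold pd; rw [fderiv_fun_mul hf hg]; simp

lemma pd_sq {f : E2 → ℝ} {x : E2} (hf : DifferentiableAt ℝ f x) (i : Fin 2) :
    pd i (fun y => f y ^ 2) x = 2 * f x * pd i f x := by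
  simp only [pow_two]; rw [pd_mul hf hf]; ring

lemma pd_const (c : ℝ) (x : E2) (i : Fin 2) : pd i (fun _ => c) x = 0 := by
  simp [pd]

lemma integral_pd {f : E2 → ℝ} (hf : ContDiff ℝ 1 f) (hc : HasCompactSupport f) (i : Fin 2) :
    ∫ x, pd i f x = 0 := by
  have h := integral_mul_fderiv_eq_neg_fderiv_mul_of_integrable (μ := (volume : Measure E2))
    (f := fun _ : E2 => (1 : ℝ)) (g := f) (v := ee i) (by simp)
    (by simp only [one_mul]; exact (pd_cont hf i).integrable_of_hasCompactSupport (pd_hcs hc i))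
    (by simpa using hf.continuous.integrable_of_hasCompactSupport hc)
    (fun x _ => differentiableAt_const _) (fun x _ => hf.differentiable one_ne_zero x)
  simpa [pd] using h

lemma jac {F g : E2 → ℝ} (hF : ContDiff ℝ 1 F) (hFc : HasCompactSupport F)
    (hg : ContDiff ℝ 1 g) (hgc : HasCompactSupport g) :
    ∫ x, (pd 0 F x * pd 1 g x - pd 1 F x * pd 0 g x) = 0 := by
  obtain ⟨C, hC⟩ := ContDiff.lipschitzWith_of_hasCompactSupport hFc hF one_ne_zero
  obtain ⟨D, hD⟩ := ContDiff.lipschitzWith_of_hasCompactSupport hgc hg one_ne_zero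
  have cF := pd_cont hF
  have cg := pd_cont hg
  have sF := pd_hcs hFc
  have sg := pd_hcs hgc
  have A := hC.integral_inv_smul_sub_mul_tendsto_integral_lineDeriv_mul
    (μ := (volume : Measure E2)) ((cg 1).integrable_of_hasCompactSupport (sg 1)) (ee 0)
  have B := hD.integral_inv_smul_sub_mul_tendsto_integral_lineDeriv_mul
    (μ := (volume : Measure E2)) ((cF 1).integrable_of_hasCompactSupport (sF 1)) (-(ee 0))
  have hdF := hF.differentiable one_ne_zero
  have hdg := hg.differentiable one_ne_zero
  have S : ∀ t : ℝ, ∫ x, (t⁻¹ • (F (x + t • ee 0) - F x)) * pd 1 g x =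
      - ∫ x, (t⁻¹ • (g (x + t • (-(ee 0))) - g x)) * pd 1 F x := by
    intro t
    have hT : ContDiff ℝ 1 (fun x => F (x + t • ee 0)) := by fun_prop
    have hpdT : ∀ x, pd 1 (fun x => F (x + t • ee 0)) x = pd 1 F (x + t • ee 0) := by
      intro x; unfold pd; rw [fderiv_comp_add_right]
    have ibp : ∀ H : E2 → ℝ, ContDiff ℝ 1 H →
        ∫ x, H x * pd 1 g x = - ∫ x, pd 1 H x * g x := by
      intro H hH
      refine integral_mul_fderiv_eq_neg_fderiv_mul_of_integrable (μ := (volume : Measure E2))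
        (f := H) (g := g) (v := ee 1) ?_ ?_ ?_
        (fun x _ => hH.differentiable one_ne_zero x) (fun x _ => hdg x)
      · exact ((pd_cont hH 1).mul hg.continuous).integrable_of_hasCompactSupport hgc.mul_left
      · exact (hH.continuous.mul (cg 1)).integrable_of_hasCompactSupport (sg 1).mul_left
      · exact (hH.continuous.mul hg.continuous).integrable_of_hasCompactSupport hgc.mul_left
    have e1 := ibp _ hT
    have e2 := ibp _ hF
    simp only [hpdT] at e1
    have e3 : ∫ x, pd 1 F (x + t • ee 0) * g x = ∫ x, pd 1 F x * g (x + t • (-(ee 0))) := by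
      rw [← integral_add_right_eq_self (μ := (volume : Measure E2))
        (fun x => pd 1 F x * g (x + t • (-(ee 0)))) (t • ee 0)]
      congr 1; ext x; congr 2; simp
    have i1 : Integrable (fun x => F (x + t • ee 0) * pd 1 g x) :=
      (hT.continuous.mul (cg 1)).integrable_of_hasCompactSupport (sg 1).mul_left
    have i2 : Integrable (fun x => F x * pd 1 g x) :=
      (hF.continuous.mul (cg 1)).integrable_of_hasCompactSupport (sg 1).mul_left
    have i3 : Integrable (fun x => pd 1 F x * g (x + t • (-(ee 0)))) := by
      refine Continuous.integrable_of_hasCompactSupport ?_ (sF 1).mul_right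
      have := hg.continuous
      have := cF 1
      fun_prop
    have i4 : Integrable (fun x => pd 1 F x * g x) :=
      ((cF 1).mul hg.continuous).integrable_of_hasCompactSupport (sF 1).mul_right
    have l : ∀ x, (t⁻¹ • (F (x + t • ee 0) - F x)) * pd 1 g x =
      t⁻¹ * (F (x + t • ee 0) * pd 1 g x - F x * pd 1 g x) := by intro x; simp; ring
    have r : ∀ x, (t⁻¹ • (g (x + t • (-(ee 0))) - g x)) * pd 1 F x =
      t⁻¹ * (pd 1 F x * g (x + t • (-(ee 0))) - pd 1 F x * g x) := by
        intro x; rw [smul_eq_mul]; ring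
    simp only [l, r]
    rw [integral_const_mul, integral_const_mul, integral_sub i1 i2, integral_sub i3 i4,
      e1, e2, e3]
    ring
  simp only [S] at A
  have L := tendsto_nhds_unique A B.neg
  simp only [(hdF _).lineDeriv_eq_fderiv, (hdg _).lineDeriv_eq_fderiv, map_neg, neg_mul,
    integral_neg, neg_neg] at L
  rw [integral_sub]
  · rw [sub_eq_zero]
    refine L.trans ?_
    congr 1; ext x; rw [mul_comm]; rfl
  · exact ((cF 0).mul (cg 1)).integrable_of_hasCompactSupport (sg 1).mul_left
  · exact ((cF 1).mul (cg 0)).integrable_of_hasCompactSupport (sg 0).mul_left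

lemma global_id (v : E2 → ℝ) (hv : ContDiff ℝ 2 v) (hvc : HasCompactSupport v)
    (ψ : E2 → ℝ) (hψ : ContDiff ℝ 2 ψ) (hψc : HasCompactSupport ψ) :
    (∫ x, (-detHess v x) * (v x) ^ 2 * ψ x)
      = -(3/2) * (∫ x, gradDot (gradSq v) v x * v x * ψ x)
        - (∫ x, (gradSq v x) ^ 2 * ψ x)
        - (∫ x, gradSq v x * gradDot v ψ x * v x)
        + (1/2) * ∫ x, (v x) ^ 2 * (gradSq v x * lap ψ x - hessQuad ψ v x) := by
  have hv1 : ContDiff ℝ 1 v := hv.of_le (by norm_num)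
  have hψ1 : ContDiff ℝ 1 ψ := hψ.of_le (by norm_num)
  have ha : ∀ i, ContDiff ℝ 1 (pd i v) := fun i => pd_contDiff (n := 1) (by norm_num; exact hv) i
  have hp : ∀ i, ContDiff ℝ 1 (pd i ψ) := fun i => pd_contDiff (n := 1) (by norm_num; exact hψ) i
  have dv := hv1.differentiable one_ne_zero
  have dψ := hψ1.differentiable one_ne_zero
  have da := fun i => (ha i).differentiable one_ne_zero
  have dp := fun i => (hp i).differentiable one_ne_zero
  have cv := hv.continuous
  have cψ := hψ.continuous
  have ca := fun i => (ha i).continuous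
  have cp := fun i => (hp i).continuous
  have ca2 : ∀ i j, Continuous (pd2 i j v) := fun i j => pd_cont (ha j) i
  have cp2 : ∀ i j, Continuous (pd2 i j ψ) := fun i j => pd_cont (hp j) i
  have z0 : ∀ x ∉ tsupport ψ, ψ x = 0 := fun x hx => image_eq_zero_of_notMem_tsupport hx
  have z1 : ∀ x ∉ tsupport ψ, ∀ i, pd i ψ x = 0 :=
    fun x hx i => pd_zero_of_ev (ev_zero_of_notMem hx) i
  have z2 : ∀ x ∉ tsupport ψ, ∀ i j, pd2 i j ψ x = 0 :=
    fun x hx i j => pd_zero_of_ev (pd_ev_zero (ev_zero_of_notMem hx) j) i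
  have cgs : Continuous (gradSq v) := by unfold gradSq; fun_prop
  have hgs : ∀ i x, pd i (gradSq v) x
      = 2 * pd 0 v x * pd2 i 0 v x + 2 * pd 1 v x * pd2 i 1 v x := by
    intro i x
    unfold gradSq
    rw [pd_add (by fun_prop) (by fun_prop), pd_sq (da 0 x), pd_sq (da 1 x)]
    rfl
  have cgs1 : ∀ i, Continuous (pd i (gradSq v)) := by
    intro i
    rw [funext (hgs i)]
    fun_prop
  have intg : ∀ f : E2 → ℝ, Continuous f → (∀ x ∉ tsupport ψ, f x = 0) → Integrable f :=
    fun f hf hz => hf.integrable_of_hasCompactSupport (HasCompactSupport.intro hψc hz)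
  have iL : Integrable (fun x => (-detHess v x) * (v x) ^ 2 * ψ x) :=
    intg _ (by unfold detHess; fun_prop) (fun x hx => by simp [z0 x hx])
  have iA : Integrable (fun x => gradDot (gradSq v) v x * v x * ψ x) :=
    intg _ (by unfold gradDot; fun_prop) (fun x hx => by simp [z0 x hx])
  have iB : Integrable (fun x => (gradSq v x) ^ 2 * ψ x) :=
    intg _ (by fun_prop) (fun x hx => by simp [z0 x hx])
  have iC : Integrable (fun x => gradSq v x * gradDot v ψ x * v x) :=
    intg _ (by unfold gradDot; fun_prop) (fun x hx => by simp [gradDot, z1 x hx])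
  have iD : Integrable (fun x => (v x) ^ 2 * (gradSq v x * lap ψ x - hessQuad ψ v x)) :=
    intg _ (by unfold lap hessQuad; fun_prop)
      (fun x hx => by simp [lap, hessQuad, z2 x hx])
  -- auxiliary fields
  let F : E2 → ℝ := fun x => pd 0 v x * (v x ^ 2 * ψ x)
  let P : Fin 2 → E2 → ℝ := fun i x => 2 * v x * ψ x * pd i v x + v x ^ 2 * pd i ψ x
  let G0 : E2 → ℝ := fun x => (-(1/2)) * (pd 1 v x ^ 2 *
      (2 * (v x * (ψ x * pd 0 v x)) + v x ^ 2 * pd 0 ψ x))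
      + v x * (ψ x * ((pd 0 v x ^ 2 + pd 1 v x ^ 2) * pd 0 v x))
  let G1 : E2 → ℝ := fun x => (-(1/2)) * (pd 0 v x ^ 2 *
      (2 * (v x * (ψ x * pd 1 v x)) + v x ^ 2 * pd 1 ψ x))
      + pd 0 v x * (pd 1 v x * (2 * (v x * (ψ x * pd 0 v x)) + v x ^ 2 * pd 0 ψ x))
      + v x * (ψ x * ((pd 0 v x ^ 2 + pd 1 v x ^ 2) * pd 1 v x))
  have hF : ContDiff ℝ 1 F := by fun_prop
  have hG0 : ContDiff ℝ 1 G0 := by fun_prop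
  have hG1 : ContDiff ℝ 1 G1 := by fun_prop
  have sF : HasCompactSupport F := HasCompactSupport.intro hψc fun x hx => by
    simp [F, z0 x hx]
  have sG0 : HasCompactSupport G0 := HasCompactSupport.intro hψc fun x hx => by
    simp [G0, z0 x hx, z1 x hx]
  have sG1 : HasCompactSupport G1 := HasCompactSupport.intro hψc fun x hx => by
    simp [G1, z0 x hx, z1 x hx]
  have J := jac hF sF (ha 1) (pd_hcs hvc 1)
  have I0 := integral_pd hG0 sG0 0
  have I1 := integral_pd hG1 sG1 1
  have iG0 : Integrable (pd 0 G0) :=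
    (pd_cont hG0 0).integrable_of_hasCompactSupport (pd_hcs sG0 0)
  have iG1 : Integrable (pd 1 G1) :=
    (pd_cont hG1 1).integrable_of_hasCompactSupport (pd_hcs sG1 1)
  have iJ : Integrable (fun x => pd 0 F x * pd 1 (pd 1 v) x - pd 1 F x * pd 0 (pd 1 v) x) := by
    refine Continuous.integrable_of_hasCompactSupport ?_
      (HasCompactSupport.intro sF fun x hx => ?_)
    · have := pd_cont hF
      have : ∀ i, Continuous (pd i (pd 1 v)) := fun i => pd_cont (ha 1) i
      fun_prop
    · simp [pd_zero_of_ev (ev_zero_of_notMem hx)]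
  have key : ∀ x, (-detHess v x) * (v x) ^ 2 * ψ x
      = (-(3/2)) * (gradDot (gradSq v) v x * v x * ψ x) - (gradSq v x) ^ 2 * ψ x
        - gradSq v x * gradDot v ψ x * v x
        + (1/2) * ((v x) ^ 2 * (gradSq v x * lap ψ x - hessQuad ψ v x))
        + (pd 0 G0 x + pd 1 G1 x
          - (pd 0 F x * pd 1 (pd 1 v) x - pd 1 F x * pd 0 (pd 1 v) x)) := by
    intro x
    have s1 : pd 1 (pd 0 v) x = pd 0 (pd 1 v) x := pd2_symm hv x 1 0
    have s2 : pd 1 (pd 0 ψ) x = pd 0 (pd 1 ψ) x := pd2_symm hψ x 1 0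
    simp (disch := fun_prop) only [F, G0, G1, pd_add, pd_mul, pd_sq, pd_const]
    simp only [gradDot, hgs]
    simp only [detHess, gradSq, lap, hessQuad, pd2, s1, s2]
    ring
  simp only [key]
  rw [integral_add (by fun_prop) (by fun_prop), integral_add (by fun_prop) (by fun_prop),
    integral_sub (by fun_prop) (by fun_prop), integral_sub (by fun_prop) (by fun_prop),
    integral_sub (by fun_prop) (by fun_prop), integral_add (by fun_prop) (by fun_prop),
    integral_const_mul, integral_const_mul, J, I0, I1]
  ring

/-- the identity for ∫ (−det D²v) v² ψ for C² functions v. -/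
theorem stmt_3 (U : Set E2) (hU : IsOpen U) (v : E2 → ℝ)
    (hv : ContDiffOn ℝ 2 v U) (ψ : E2 → ℝ) (hψ : IsTestOn ψ U) :
    (∫ x in U, (-detHess v x) * (v x) ^ 2 * ψ x)
      = -(3/2) * (∫ x in U, gradDot (gradSq v) v x * v x * ψ x)
        - (∫ x in U, (gradSq v x) ^ 2 * ψ x)
        - (∫ x in U, gradSq v x * gradDot v ψ x * v x)
        + (1/2) * ∫ x in U, (v x) ^ 2 * (gradSq v x * lap ψ x - hessQuad ψ v x) := by
  obtain ⟨hψs, hψc, hψU⟩ := hψ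
  obtain ⟨K, hK, hψK, hKU⟩ := exists_compact_between hψc hU hψU
  obtain ⟨χ, hχ1, hχ0, -⟩ := exists_contMDiffMap_one_nhds_of_subset_interior
    (n := (2 : ℕ∞)) (modelWithCornersSelf ℝ E2) (isClosed_tsupport ψ) hψK
  have hχs : ContDiff ℝ 2 (χ : E2 → ℝ) := χ.contMDiff.contDiff
  have hsub : tsupport (χ : E2 → ℝ) ⊆ K := by
    refine closure_minimal (fun x hx => ?_) hK.isClosed
    by_contra h
    exact hx (hχ0 x h)
  let w : E2 → ℝ := fun x => χ x * v x
  have hw : ContDiff ℝ 2 w := by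
    rw [contDiff_iff_contDiffAt]
    intro x
    by_cases hx : x ∈ U
    · exact hχs.contDiffAt.mul (hv.contDiffAt (hU.mem_nhds hx))
    · have h0 : w =ᶠ[nhds x] fun _ => 0 := by
        filter_upwards [ev_zero_of_notMem (fun h => hx (hKU (hsub h)))] with y hy
        simp [w, hy]
      exact contDiffAt_const.congr_of_eventuallyEq h0
  have hwc : HasCompactSupport w := HasCompactSupport.intro hK fun x hx => by
    simp [w, hχ0 x hx]
  have hev : ∀ x ∈ tsupport ψ, v =ᶠ[nhds x] w := by
    intro x hx
    have := Filter.Eventually.filter_mono (nhds_le_nhdsSet hx) hχ1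
    filter_upwards [this] with y hy
    simp [w, hy]
  have G := global_id w hw hwc ψ (contDiff_infty.mp hψs 2) hψc
  have red : ∀ f g : E2 → ℝ, (∀ x ∉ tsupport ψ, f x = 0 ∧ g x = 0) →
      (∀ x ∈ tsupport ψ, f x = g x) → ∫ x in U, f x = ∫ x, g x := by
    intro f g h0 h1
    rw [setIntegral_eq_integral_of_forall_compl_eq_zero
      (fun x hx => (h0 x (fun h => hx (hψU h))).1)]
    congr 1; ext x
    by_cases hx : x ∈ tsupport ψ
    · exact h1 x hx
    · rw [(h0 x hx).1, (h0 x hx).2]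
  have z0 : ∀ x ∉ tsupport ψ, ψ x = 0 := fun x hx => image_eq_zero_of_notMem_tsupport hx
  have z1 : ∀ x ∉ tsupport ψ, ∀ i, pd i ψ x = 0 :=
    fun x hx i => pd_zero_of_ev (ev_zero_of_notMem hx) i
  have z2 : ∀ x ∉ tsupport ψ, ∀ i j, pd2 i j ψ x = 0 :=
    fun x hx i j => pd_zero_of_ev (pd_ev_zero (ev_zero_of_notMem hx) j) i
  have e0 : ∀ x ∈ tsupport ψ, v x = w x := fun x hx => (hev x hx).eq_of_nhds
  have e1 : ∀ x ∈ tsupport ψ, ∀ i, pd i v x = pd i w x := fun x hx i => pd_congr (hev x hx) i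
  have e2 : ∀ x ∈ tsupport ψ, ∀ i j, pd2 i j v x = pd2 i j w x :=
    fun x hx i j => pd_congr (pd_congr_ev (hev x hx) j) i
  have e3 : ∀ x ∈ tsupport ψ, ∀ i, pd i (gradSq v) x = pd i (gradSq w) x := by
    intro x hx i
    apply pd_congr
    filter_upwards [pd_congr_ev (hev x hx) 0, pd_congr_ev (hev x hx) 1] with y h0 h1
    simp [gradSq, h0, h1]
  rw [red _ (fun x => (-detHess w x) * (w x) ^ 2 * ψ x)
      (fun x hx => by simp [z0 x hx]) (fun x hx => by simp only [detHess, e0 x hx, e2 x hx]),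
    red _ (fun x => gradDot (gradSq w) w x * w x * ψ x)
      (fun x hx => by simp [z0 x hx])
      (fun x hx => by simp only [gradDot, e0 x hx, e1 x hx, e3 x hx]),
    red _ (fun x => (gradSq w x) ^ 2 * ψ x)
      (fun x hx => by simp [z0 x hx]) (fun x hx => by simp only [gradSq, e1 x hx]),
    red _ (fun x => gradSq w x * gradDot w ψ x * w x)
      (fun x hx => by simp [gradDot, z1 x hx])
      (fun x hx => by simp only [gradSq, gradDot, e0 x hx, e1 x hx]),
    red _ (fun x => (w x) ^ 2 * (gradSq w x * lap ψ x - hessQuad ψ w x))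
      (fun x hx => by simp [lap, hessQuad, z2 x hx])
      (fun x hx => by simp only [gradSq, lap, hessQuad, e0 x hx, e1 x hx])]
  exact G
end
end

section
/- There exists an absolute constant C > 0 with the following property. Let U ⊆ ℝ² be open, ε > 0, and let v ∈ C^∞(U) satisfy Δ∞v + ε Δv = 0 at every point of U. Then for every β > −1, every δ > 0, and every φ ∈ C_c^∞(U): ∫_U −det D[(|Dv|² + δ)^{β/2} Dv] φ² dx ≤ C ((1 + β²)/(1 + β)) ∫_U (|Dv|² + δ)^{β+1} ( |φ| |D²φ| + |Dφ|² ) dx. -/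
open Real MeasureTheory
open scoped RealInnerProductSpace

noncomputable section

/-- Differentiability at a point, with prescribed partial derivative. -/
def HP (i : Fin 2) (f : E2 → ℝ) (f' : ℝ) (x : E2) : Prop :=
  ∃ L : E2 →L[ℝ] ℝ, HasFDerivAt f L x ∧ L (ee i) = f'

lemma HP.pd {i : Fin 2} {f : E2 → ℝ} {f' : ℝ} {x : E2} (h : HP i f f' x) : pd i f x = f' := by
  obtain ⟨L, hL, h2⟩ := h
  rw [_root_.pd, hL.fderiv, h2]

abbrev Sm (f : E2 → ℝ) (x : E2) : Prop := ContDiffAt ℝ (⊤ : ℕ∞) f x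

lemma Sm.hp {f : E2 → ℝ} {x : E2} (h : Sm f x) (i : Fin 2) : HP i f (_root_.pd i f x) x :=
  ⟨_, (h.differentiableAt (by simp)).hasFDerivAt, rfl⟩

lemma HP.add {i : Fin 2} {f g : E2 → ℝ} {f' g' : ℝ} {x : E2} (hf : HP i f f' x)
    (hg : HP i g g' x) : HP i (fun y => f y + g y) (f' + g') x := by
  obtain ⟨L, hL, rfl⟩ := hf
  obtain ⟨M, hM, rfl⟩ := hg
  exact ⟨_, hL.add hM, by simp⟩

lemma HP.sub {i : Fin 2} {f g : E2 → ℝ} {f' g' : ℝ} {x : E2} (hf : HP i f f' x)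
    (hg : HP i g g' x) : HP i (fun y => f y - g y) (f' - g') x := by
  obtain ⟨L, hL, rfl⟩ := hf
  obtain ⟨M, hM, rfl⟩ := hg
  exact ⟨_, hL.sub hM, by simp⟩

lemma HP.mul {i : Fin 2} {f g : E2 → ℝ} {f' g' : ℝ} {x : E2} (hf : HP i f f' x)
    (hg : HP i g g' x) : HP i (fun y => f y * g y) (f' * g x + f x * g') x := by
  obtain ⟨L, hL, rfl⟩ := hf
  obtain ⟨M, hM, rfl⟩ := hg
  exact ⟨_, hL.mul hM, by simp; ring⟩

lemma HP.const (i : Fin 2) (c : ℝ) (x : E2) : HP i (fun _ => c) 0 x :=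
  ⟨_, hasFDerivAt_const c x, by simp⟩

lemma HP.rpow {i : Fin 2} {f : E2 → ℝ} {f' : ℝ} {x : E2} (hf : HP i f f' x) (p : ℝ)
    (h0 : f x ≠ 0) : HP i (fun y => f y ^ p) (p * f x ^ (p - 1) * f') x := by
  obtain ⟨L, hL, rfl⟩ := hf
  exact ⟨_, hL.rpow_const (Or.inl h0), by simp⟩

lemma Sm.pd {f : E2 → ℝ} {x : E2} (h : Sm f x) (i : Fin 2) : Sm (pd i f) x := by
  have h1 : ContDiffAt ℝ (⊤ : ℕ∞) (fderiv ℝ f) x := h.fderiv_right (by simp)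
  exact h1.clm_apply contDiffAt_const

lemma Sm.comm {f : E2 → ℝ} {x : E2} (h : Sm f x) :
    _root_.pd 0 (_root_.pd 1 f) x = _root_.pd 1 (_root_.pd 0 f) x := by
  have h1 : ContDiffAt ℝ (⊤ : ℕ∞) (fderiv ℝ f) x := h.fderiv_right (by simp)
  have h2 := (h1.differentiableAt (by simp)).hasFDerivAt
  have key : ∀ i j, _root_.pd i (_root_.pd j f) x = fderiv ℝ (fderiv ℝ f) x (ee i) (ee j) := by
    intro i j
    have := h2.clm_apply (hasFDerivAt_const (ee j) x)
    unfold _root_.pd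
    rw [this.fderiv]
    simp
  rw [key, key]
  have hs : IsSymmSndFDerivAt ℝ f x := h.isSymmSndFDerivAt (by simp only [minSmoothness_of_isRCLikeNormedField]; exact WithTop.coe_le_coe.2 (le_top : (2:ℕ∞) ≤ ⊤))
  exact hs _ _

/-- The integral of a partial derivative of a compactly supported function vanishes. -/
lemma int_pd (i : Fin 2) (f : E2 → ℝ) (hf : ContDiff ℝ (⊤ : ℕ∞) f) (hc : HasCompactSupport f) :
    Integrable (pd i f) ∧ ∫ x, pd i f x = 0 := by
  have hd : Integrable (fun x => fderiv ℝ f x (ee i)) := by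
    have h1 : Continuous (fderiv ℝ f) := hf.continuous_fderiv (by simp)
    refine Continuous.integrable_of_hasCompactSupport (by fun_prop) ?_
    exact (hc.fderiv_apply (𝕜 := ℝ) (ee i))
  refine ⟨hd, ?_⟩
  have := integral_mul_fderiv_eq_neg_fderiv_mul_of_integrable (𝕜 := ℝ) (μ := (volume : Measure E2))
    (f := fun _ => (1:ℝ)) (g := f) (v := ee i) (by simp) (by simpa using hd)
    (by simpa using hf.continuous.integrable_of_hasCompactSupport hc)
    (by fun_prop) (fun x _ => hf.differentiable (by simp) x)
  simpa [pd] using this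

set_option maxHeartbeats 1000000 in
/-- Pointwise algebraic inequality. -/
lemma alg (a b a0 m b1 f f0 f1 f00 f01 f10 f11 δ β ε P F : ℝ) (hδ : 0 < δ) (hβ : -1 < β)
    (hε : 0 < ε) (hP : 0 < P) (hF : 0 ≤ F)
    (hF2 : F ^ 2 = f00 ^ 2 + f01 ^ 2 + f10 ^ 2 + f11 ^ 2)
    (heq : a0 * a * a + m * a * b + m * b * a + b1 * b * b + ε * (a0 + b1) = 0)
    (N Z : ℝ) (hN : N = -(P * (a0 * b1 - m * m) * (δ + (1 + β) * (a^2 + b^2))) * f ^ 2)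
    (hZ : 2 * N = Z - 4 * β * P * (a0 * a * a + m * a * b + m * b * a + b1 * b * b) * f
        * (a * f0 + b * f1)
      - P * (a^2+b^2+δ) * (2 * (a * f0 + b * f1)^2
          + 2 * f * (f00 * a * a + f01 * a * b + f10 * b * a + f11 * b * b))
      + P * (a^2+b^2+δ)^2 * (2 * (f0^2+f1^2) + 2 * f * (f00 + f11)) / (1 + β)) :
    N ≤ Z + 8 * ((1+β^2)/(1+β)) * (P * (a^2+b^2+δ)^2 * (|f| * F + (f0^2+f1^2))) := by
  have hb : 0 < 1 + β := by linarith
  set g := a^2+b^2 with hg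
  have hg0 : 0 ≤ g := by positivity
  set K := (1+β^2)/(1+β) with hK
  have hKmul : K * (1+β) = 1 + β^2 := by rw [hK]; field_simp
  have hK1 : 1 ≤ 2 * K := by
    by_contra hcon
    nlinarith [sq_nonneg (β - 1), sq_nonneg β]
  have hK0 : 0 < K := by linarith
  have hK2 : 1 / (1+β) ≤ K := by
    rw [hK]; gcongr; nlinarith [sq_nonneg β]
  have hK3 : β^2 / (1+β) ≤ K := by
    rw [hK]; gcongr; linarith
  set q := -(a0 * b1 - m * m) with hq
  have hid : g * q = (a0 * a + m * b)^2 + (m * a + b1 * b)^2 + ε * (a0 + b1)^2 := by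
    rw [hg, hq]; linear_combination -(a0 + b1) * heq
  have hq0 : 0 ≤ q := by
    rcases hg0.lt_or_eq with h | h
    · have : 0 ≤ g * q := by rw [hid]; positivity
      exact nonneg_of_mul_nonneg_right this h
    · have ha : a = 0 := by
        have : a ^ 2 = 0 := by linarith [sq_nonneg a, sq_nonneg b]
        exact pow_eq_zero_iff (two_ne_zero) |>.1 this
      have hbb : b = 0 := by
        have : b ^ 2 = 0 := by linarith [sq_nonneg a, sq_nonneg b]
        exact pow_eq_zero_iff (two_ne_zero) |>.1 this
      have : a0 + b1 = 0 := by
        rw [ha, hbb] at heq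
        have : ε * (a0 + b1) = 0 := by linarith
        rcases mul_eq_zero.1 this with h | h
        · linarith
        · exact h
      have : a0 = - b1 := by linarith
      rw [hq, this]; linarith [sq_nonneg b1, sq_nonneg m]
  set I := a0 * a * a + m * a * b + m * b * a + b1 * b * b with hI
  set Y := a * f0 + b * f1 with hY
  set d := f0^2+f1^2 with hd
  have hd0 : 0 ≤ d := by positivity
  have hI2 : I^2 ≤ g * (g * q) := by
    have : I^2 ≤ g * ((a0 * a + m * b)^2 + (m * a + b1 * b)^2) := by
      rw [hI, hg]; linarith only [sq_nonneg (a * (m * a + b1 * b) - b * (a0 * a + m * b))]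
    refine this.trans ?_
    rw [hid]; refine mul_le_mul_of_nonneg_left ?_ hg0; linarith [mul_nonneg hε.le (sq_nonneg (a0+b1))]
  have hY2 : Y^2 ≤ g * d := by
    rw [hY, hg, hd]; linarith only [sq_nonneg (a * f1 - b * f0)]
  have hcs : -(4 * β * I * f * Y) ≤ (1+β) * (q * g * f^2) + 4 * (β^2/(1+β)) * (g^2 * d) := by
    have hnn : 0 ≤ (1+β) * (q * g * f^2) + 4 * (β^2/(1+β)) * (g^2 * d) := by positivity
    refine (neg_le_abs _).trans (abs_le_of_sq_le_sq ?_ hnn)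
    have h1 : (4 * β * I * f * Y)^2 ≤ 16 * β^2 * (q * g * f^2) * (g^2 * d) := by
      have : I^2 * Y^2 ≤ (g * (g * q)) * (g * d) := by gcongr
      calc _ = 16 * β^2 * f^2 * (I^2 * Y^2) := by ring
        _ ≤ 16 * β^2 * f^2 * ((g * (g * q)) * (g * d)) := by gcongr
        _ = _ := by ring
    have h2 : 16 * β^2 * (q * g * f^2) * (g^2 * d)
        = 4 * ((1+β) * (q * g * f^2)) * (4 * (β^2/(1+β)) * (g^2 * d)) := by
      field_simp; ring
    rw [h2] at h1
    exact h1.trans (four_mul_le_sq_add _ _)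
  set s := g + δ with hs
  have hs0 : 0 < s := by positivity
  have hgs : g ≤ s := by linarith
  clear_value g K q I Y d s
  have t1 : -(4 * β * P * I * f * Y) ≤ N + 4 * K * (P * s^2 * d) := by
    have e1 : (1+β) * (q * g * f^2) * P ≤ N := by
      have : N = P * q * (δ + (1+β) * g) * f^2 := by rw [hN, hq]; ring
      rw [this]
      have : 0 ≤ P * q * δ * f^2 := by positivity
      nlinarith
    have e2 : 4 * (β^2/(1+β)) * (g^2 * d) * P ≤ 4 * K * (P * s^2 * d) := by
      calc _ ≤ 4 * K * (s^2 * d) * P := by gcongr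
        _ = _ := by ring
    have h5 := mul_le_mul_of_nonneg_right hcs hP.le
    linarith only [h5, e1, e2]
  have t2 : -(P * s * (2 * Y^2 + 2 * f * (f00 * a * a + f01 * a * b + f10 * b * a + f11 * b * b)))
      ≤ 4 * K * (P * s^2 * (|f| * F)) := by
    set J := f00 * a * a + f01 * a * b + f10 * b * a + f11 * b * b with hJ
    have hJ2 : |J| ≤ F * g := by
      refine abs_le_of_sq_le_sq ?_ (by positivity)
      have e : (F*g)^2 = (f00 ^ 2 + f01 ^ 2 + f10 ^ 2 + f11 ^ 2) * ((a*a)^2+(a*b)^2+(b*a)^2+(b*b)^2) := by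
        rw [mul_pow, hF2, hg]; ring
      rw [e, hJ]
      linarith only [sq_nonneg (f00 * (a*b) - f01 * (a*a)), sq_nonneg (f00 * (b*a) - f10 * (a*a)),
        sq_nonneg (f00 * (b*b) - f11 * (a*a)), sq_nonneg (f01 * (b*a) - f10 * (a*b)),
        sq_nonneg (f01 * (b*b) - f11 * (a*b)), sq_nonneg (f10 * (b*b) - f11 * (b*a))]
    have e1 : -(f * J) ≤ |f| * (F * s) := by
      refine (neg_le_abs _).trans ?_
      rw [abs_mul]
      exact mul_le_mul_of_nonneg_left (hJ2.trans (by gcongr)) (abs_nonneg _)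
    have e2 : 0 ≤ P * s := by positivity
    have e3 := mul_le_mul_of_nonneg_left e1 e2
    have e4 : 0 ≤ P * s * Y^2 := by positivity
    have e5 : 0 ≤ P * s^2 * (|f| * F) := by positivity
    have e6 := mul_le_mul_of_nonneg_right hK1 e5
    linarith only [e3, e4, e6]
  have t3 : P * s^2 * (2 * d + 2 * f * (f00 + f11)) / (1+β) ≤ 4 * K * (P * s^2 * (|f| * F + d)) := by
    have e1 : f * (f00 + f11) ≤ |f| * (2 * F) := by
      refine (le_abs_self _).trans ?_
      rw [abs_mul]
      refine mul_le_mul_of_nonneg_left ?_ (abs_nonneg _)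
      refine abs_le_of_sq_le_sq ?_ (by positivity)
      linarith only [hF2, sq_nonneg f00, sq_nonneg f11, sq_nonneg (f00 - f11), sq_nonneg f01, sq_nonneg f10]
    have e2 : 2 * d + 2 * f * (f00 + f11) ≤ 4 * (|f| * F + d) := by linarith only [e1, hd0]
    calc _ = P * s^2 * (2 * d + 2 * f * (f00 + f11)) * (1 / (1+β)) := by ring
      _ ≤ P * s^2 * (4 * (|f| * F + d)) * (1 / (1+β)) := by gcongr
      _ ≤ P * s^2 * (4 * (|f| * F + d)) * K := by gcongr
      _ = _ := by ring
  linarith only [t1, t2, t3, hZ]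

lemma cd_of_supp {f : E2 → ℝ} {K : Set E2} (hK : IsClosed K) (h : ∀ x ∈ K, Sm f x)
    (h0 : ∀ x ∉ K, f x = 0) : ContDiff ℝ (⊤ : ℕ∞) f := by
  rw [contDiff_iff_contDiffAt]
  intro x
  by_cases hx : x ∈ K
  · exact h x hx
  · have : f =ᶠ[nhds x] fun _ => 0 := by
      filter_upwards [hK.isOpen_compl.mem_nhds hx] with y hy using h0 y hy
    exact contDiffAt_const.congr_of_eventuallyEq this

def Z0 (v φ : E2 → ℝ) (β δ : ℝ) (y : E2) : ℝ :=
  (φ y * φ y) * ((gradSq v y + δ) ^ β *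
      (pd 1 (pd 0 v) y * pd 1 v y - pd 1 (pd 1 v) y * pd 0 v y))
    + 2 * ((gradSq v y + δ) ^ β *
      (φ y * ((pd 0 v y * pd 0 φ y + pd 1 v y * pd 1 φ y) * pd 0 v y)))
    - (2 / (1 + β)) * ((gradSq v y + δ) ^ (β + 1) * (φ y * pd 0 φ y))

def Z1 (v φ : E2 → ℝ) (β δ : ℝ) (y : E2) : ℝ :=
  (φ y * φ y) * ((gradSq v y + δ) ^ β *
      (pd 0 (pd 1 v) y * pd 0 v y - pd 0 (pd 0 v) y * pd 1 v y))
    + 2 * ((gradSq v y + δ) ^ β *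
      (φ y * ((pd 0 v y * pd 0 φ y + pd 1 v y * pd 1 φ y) * pd 1 v y)))
    - (2 / (1 + β)) * ((gradSq v y + δ) ^ (β + 1) * (φ y * pd 1 φ y))

lemma gradSq_nonneg' (v : E2 → ℝ) (x : E2) : 0 ≤ gradSq v x := by
  unfold gradSq; positivity

lemma Sm.gs {v : E2 → ℝ} {x : E2} (hv : Sm v x) (δ : ℝ) :
    Sm (fun y => gradSq v y + δ) x := by
  have h0 := hv.pd 0
  have h1 := hv.pd 1
  unfold gradSq
  exact ((h0.pow 2).add (h1.pow 2)).add contDiffAt_const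

lemma Sm.gsp {v : E2 → ℝ} {x : E2} (hv : Sm v x) {δ : ℝ} (hδ : 0 < δ) (p : ℝ) :
    Sm (fun y => (gradSq v y + δ) ^ p) x :=
  (hv.gs δ).rpow_const_of_ne (by have := gradSq_nonneg' v x; positivity)

lemma hp_gs {v : E2 → ℝ} {x : E2} (hv : Sm v x) (δ : ℝ) (i : Fin 2) :
    HP i (fun y => gradSq v y + δ)
      (2 * (pd 0 v x * pd i (pd 0 v) x + pd 1 v x * pd i (pd 1 v) x)) x := by
  have h0 := (hv.pd 0).hp i
  have h1 := (hv.pd 1).hp i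
  have := ((h0.mul h0).add (h1.mul h1)).add (HP.const i δ x)
  unfold gradSq
  simp only [pow_two]
  convert this using 1
  ring

lemma Sm.z0 {v φ : E2 → ℝ} {x : E2} (hv : Sm v x) (hφ : Sm φ x) {δ : ℝ} (hδ : 0 < δ) (β : ℝ) :
    Sm (Z0 v φ β δ) x := by
  have A := hv.pd 0
  have B := hv.pd 1
  have A1 := (hv.pd 0).pd 1
  have B1 := (hv.pd 1).pd 1
  have p0 := hφ.pd 0
  have p1 := hφ.pd 1
  have S := hv.gsp hδ β
  have T := hv.gsp hδ (β + 1)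
  exact (((hφ.mul hφ).mul (S.mul ((A1.mul B).sub (B1.mul A)))).add (contDiffAt_const.mul
    (S.mul (hφ.mul (((A.mul p0).add (B.mul p1)).mul A))))).sub
    (contDiffAt_const.mul (T.mul (hφ.mul p0)))

lemma Sm.z1 {v φ : E2 → ℝ} {x : E2} (hv : Sm v x) (hφ : Sm φ x) {δ : ℝ} (hδ : 0 < δ) (β : ℝ) :
    Sm (Z1 v φ β δ) x := by
  have A := hv.pd 0
  have B := hv.pd 1
  have A0 := (hv.pd 0).pd 0
  have B0 := (hv.pd 1).pd 0
  have p0 := hφ.pd 0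
  have p1 := hφ.pd 1
  have S := hv.gsp hδ β
  have T := hv.gsp hδ (β + 1)
  exact (((hφ.mul hφ).mul (S.mul ((B0.mul A).sub (A0.mul B)))).add (contDiffAt_const.mul
    (S.mul (hφ.mul (((A.mul p0).add (B.mul p1)).mul B))))).sub
    (contDiffAt_const.mul (T.mul (hφ.mul p1)))

set_option maxHeartbeats 1000000 in
lemma point {v φ : E2 → ℝ} {x : E2} (hv : Sm v x) (hφ : Sm φ x) {δ ε β : ℝ} (hδ : 0 < δ)
    (hε : 0 < ε) (hβ : -1 < β) (heq : infLap v x + ε * lap v x = 0) :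
    (-jdet (fun i y => (gradSq v y + δ) ^ (β/2) * pd i v y) x) * (φ x) ^ 2 ≤
     (pd 0 (Z0 v φ β δ) x + pd 1 (Z1 v φ β δ) x) + 8 * ((1 + β^2)/(1 + β)) *
       ((gradSq v x + δ) ^ (β+1) * (|φ x| * Real.sqrt (hessFrobSq φ x) + gradSq φ x)) := by
  have hb : 1 + β ≠ 0 := by linarith
  have hg := gradSq_nonneg' v x
  have hs : 0 < gradSq v x + δ := by positivity
  have a_ := fun i => (hv.pd 0).hp i
  have b_ := fun i => (hv.pd 1).hp i
  have p_ := fun i => hφ.hp i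
  have p0_ := fun i => (hφ.pd 0).hp i
  have p1_ := fun i => (hφ.pd 1).hp i
  have S_ := fun i p => (hp_gs hv δ i).rpow p hs.ne'
  have J00 := ((S_ 0 (β/2)).mul (a_ 0)).pd
  have J10 := ((S_ 1 (β/2)).mul (a_ 1)).pd
  have J01 := ((S_ 0 (β/2)).mul (b_ 0)).pd
  have J11 := ((S_ 1 (β/2)).mul (b_ 1)).pd
  have W := fun i => (((a_ i).mul (p0_ i)).add ((b_ i).mul (p1_ i)))
  have D0 := (((((p_ 0).mul (p_ 0)).mul ((S_ 0 β).mul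
    (((((hv.pd 0).pd 1).hp 0).mul (b_ 0)).sub ((((hv.pd 1).pd 1).hp 0).mul (a_ 0))))).add
    ((HP.const 0 2 x).mul ((S_ 0 β).mul ((p_ 0).mul ((W 0).mul (a_ 0)))))).sub
    ((HP.const 0 (2 / (1 + β)) x).mul ((S_ 0 (β+1)).mul ((p_ 0).mul (p0_ 0))))).pd
  have D1 := (((((p_ 1).mul (p_ 1)).mul ((S_ 1 β).mul
    (((((hv.pd 1).pd 0).hp 1).mul (a_ 1)).sub ((((hv.pd 0).pd 0).hp 1).mul (b_ 1))))).add
    ((HP.const 1 2 x).mul ((S_ 1 β).mul ((p_ 1).mul ((W 1).mul (b_ 1)))))).sub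
    ((HP.const 1 (2 / (1 + β)) x).mul ((S_ 1 (β+1)).mul ((p_ 1).mul (p1_ 1))))).pd
  change pd 0 (Z0 v φ β δ) x = _ at D0
  change pd 1 (Z1 v φ β δ) x = _ at D1
  have c1 := hv.comm
  have c2 := (hv.pd 0).comm
  have c3 := (hv.pd 1).comm
  have r1 : (gradSq v x + δ) ^ β = (gradSq v x + δ) ^ (β - 1) * (gradSq v x + δ) := by
    rw [← Real.rpow_add_one hs.ne']; congr 1; ring
  have r2 : (gradSq v x + δ) ^ (β + 1) = (gradSq v x + δ) ^ (β - 1) * (gradSq v x + δ)^2 := by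
    rw [Real.rpow_add_one hs.ne', r1]; ring
  have r3 : (gradSq v x + δ) ^ (β / 2) = (gradSq v x + δ) ^ (β / 2 - 1) * (gradSq v x + δ) := by
    rw [← Real.rpow_add_one hs.ne']; congr 1; ring
  have r4 : (gradSq v x + δ) ^ (β - 1)
      = ((gradSq v x + δ) ^ (β / 2 - 1))^2 * (gradSq v x + δ) := by
    rw [← Real.rpow_natCast, ← Real.rpow_mul hs.le, ← Real.rpow_add_one hs.ne']
    congr 1; push_cast; ring
  have hP : 0 < (gradSq v x + δ) ^ (β - 1) := Real.rpow_pos_of_pos hs _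
  have r5 : β + 1 - 1 = β := by ring
  rw [r5] at D0 D1
  have hjd : jdet (fun i y => (gradSq v y + δ) ^ (β/2) * pd i v y) x =
     pd 0 (fun y => (gradSq v y + δ) ^ (β/2) * pd 0 v y) x
      * pd 1 (fun y => (gradSq v y + δ) ^ (β/2) * pd 1 v y) x
      - pd 1 (fun y => (gradSq v y + δ) ^ (β/2) * pd 0 v y) x
      * pd 0 (fun y => (gradSq v y + δ) ^ (β/2) * pd 1 v y) x := rfl
  rw [J00, J11, J10, J01] at hjd
  rw [r3] at hjd
  rw [r2, r1] at D0 D1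
  rw [r2]
  have hF0 : 0 ≤ hessFrobSq φ x := by unfold hessFrobSq; positivity
  have hF2 := Real.sq_sqrt hF0
  have hFn := Real.sqrt_nonneg (hessFrobSq φ x)
  generalize Real.sqrt (hessFrobSq φ x) = F at *
  unfold hessFrobSq pd2 at hF2
  unfold infLap lap pd2 at heq
  generalize (gradSq v x + δ) ^ (β - 1) = P at *
  generalize (gradSq v x + δ) ^ (β / 2 - 1) = Q at *
  generalize jdet (fun i y => (gradSq v y + δ) ^ (β/2) * pd i v y) x = J at *
  generalize pd 0 (Z0 v φ β δ) x = z0 at *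
  generalize pd 1 (Z1 v φ β δ) x = z1 at *
  have hgv : gradSq v x = pd 0 v x ^ 2 + pd 1 v x ^ 2 := rfl
  have hgp : gradSq φ x = pd 0 φ x ^ 2 + pd 1 φ x ^ 2 := rfl
  rw [hgv] at hjd D0 D1 r4 ⊢
  rw [hgp]
  try rw [c1] at heq
  try rw [c1] at hjd
  try rw [c1] at D0
  try rw [c1] at D1
  try rw [c2] at D0
  try rw [c2] at D1
  try rw [c3] at D0
  try rw [c3] at D1
  clear hg hs J00 J01 J10 J11 W S_ a_ b_ p_ p0_ p1_ r1 r2 r3 hgv hgp c1 c2 c3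
  generalize pd 1 (pd 0 (pd 0 v)) x = t1 at *
  generalize pd 1 (pd 0 (pd 1 v)) x = t2 at *
  generalize pd 0 (pd 0 v) x = a0 at *
  generalize pd 1 (pd 0 v) x = m at *
  generalize pd 1 (pd 1 v) x = b1 at *
  generalize pd 0 v x = a at *
  generalize pd 1 v x = b at *
  generalize pd 0 (pd 0 φ) x = f00 at *
  generalize pd 0 (pd 1 φ) x = f01 at *
  generalize pd 1 (pd 0 φ) x = f10 at *
  generalize pd 1 (pd 1 φ) x = f11 at *
  generalize pd 0 φ x = f0 at *
  generalize pd 1 φ x = f1 at *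
  generalize φ x = f at *
  have hN : -J * f^2 = -(P * (a0 * b1 - m * m) * (δ + (1 + β) * (a^2 + b^2))) * f ^ 2 := by
    rw [hjd, r4]; ring
  refine alg a b a0 m b1 f f0 f1 f00 f01 f10 f11 δ β ε P F hδ hβ hε hP hFn hF2 heq _ _ hN ?_
  rw [hN, D0, D1]
  field_simp
  ring

theorem stmt_15 : ∃ C : ℝ, 0 < C ∧
    ∀ (U : Set E2), IsOpen U → ∀ ε : ℝ, 0 < ε →
    ∀ v : E2 → ℝ, ContDiffOn ℝ (⊤ : ℕ∞) v U →
    (∀ x ∈ U, infLap v x + ε * lap v x = 0) →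
    ∀ β : ℝ, -1 < β → ∀ δ : ℝ, 0 < δ →
    ∀ φ : E2 → ℝ, IsTestOn φ U →
    (∫ x in U, (-jdet (fun i y => (gradSq v y + δ) ^ (β/2) * pd i v y) x) * (φ x) ^ 2)
      ≤ C * ((1 + β^2)/(1 + β)) *
          ∫ x in U, (gradSq v x + δ) ^ (β+1)
            * (|φ x| * Real.sqrt (hessFrobSq φ x) + gradSq φ x) := by
  refine ⟨8, by norm_num, ?_⟩
  intro U hU ε hε v hv heq β hβ δ hδ φ ⟨hφ, hφc, hφU⟩
  set K := tsupport φ with hK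
  have hKc : IsCompact K := hφc
  have hKcl : IsClosed K := isClosed_tsupport φ
  have sv : ∀ x ∈ K, Sm v x := fun x hx => hv.contDiffAt (hU.mem_nhds (hφU hx))
  have sφ : ∀ x, Sm φ x := fun x => hφ.contDiffAt
  have φ0 : ∀ x ∉ K, φ x = 0 := fun x hx => image_eq_zero_of_notMem_tsupport hx
  have pφ0 : ∀ i, ∀ x ∉ K, pd i φ x = 0 := by
    intro i x hx
    have : φ =ᶠ[nhds x] fun _ => 0 := notMem_tsupport_iff_eventuallyEq.1 hx
    rw [pd, this.fderiv_eq]; simp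
  have z0s : ∀ x ∉ K, Z0 v φ β δ x = 0 := by
    intro x hx; simp [Z0, φ0 x hx]
  have z1s : ∀ x ∉ K, Z1 v φ β δ x = 0 := by
    intro x hx; simp [Z1, φ0 x hx]
  have z0d := cd_of_supp hKcl (fun x hx => (sv x hx).z0 (sφ x) hδ β) z0s
  have z1d := cd_of_supp hKcl (fun x hx => (sv x hx).z1 (sφ x) hδ β) z1s
  obtain ⟨i0, e0⟩ := int_pd 0 _ z0d (HasCompactSupport.intro hKc z0s)
  obtain ⟨i1, e1⟩ := int_pd 1 _ z1d (HasCompactSupport.intro hKc z1s)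
  have pz : ∀ f : E2 → ℝ, (∀ x ∉ K, f x = 0) → ∀ i, ∀ x ∉ K, pd i f x = 0 := by
    intro f hf i x hx
    have : f =ᶠ[nhds x] fun _ => 0 := by
      filter_upwards [hKcl.isOpen_compl.mem_nhds hx] with y hy using hf y hy
    rw [pd, this.fderiv_eq]; simp
  have e : ∫ x in K, (pd 0 (Z0 v φ β δ) x + pd 1 (Z1 v φ β δ) x) = 0 := by
    rw [setIntegral_eq_integral_of_forall_compl_eq_zero, integral_add i0 i1, e0, e1, add_zero]
    intro x hx
    rw [pz _ z0s 0 x hx, pz _ z1s 1 x hx, add_zero]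
  have hL : ∫ x in U, (-jdet (fun i y => (gradSq v y + δ) ^ (β/2) * pd i v y) x) * (φ x) ^ 2
      = ∫ x in K, (-jdet (fun i y => (gradSq v y + δ) ^ (β/2) * pd i v y) x) * (φ x) ^ 2 := by
    refine setIntegral_eq_of_subset_of_forall_sdiff_eq_zero hU.measurableSet hφU ?_
    intro x hx
    simp [φ0 x hx.2]
  have hR : ∫ x in U, (gradSq v x + δ) ^ (β+1)
            * (|φ x| * Real.sqrt (hessFrobSq φ x) + gradSq φ x)
      = ∫ x in K, (gradSq v x + δ) ^ (β+1)
            * (|φ x| * Real.sqrt (hessFrobSq φ x) + gradSq φ x) := by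
    refine setIntegral_eq_of_subset_of_forall_sdiff_eq_zero hU.measurableSet hφU ?_
    intro x hx
    simp [φ0 x hx.2, gradSq, pφ0 _ x hx.2]
  rw [hL, hR]
  have iL : IntegrableOn
      (fun x => (-jdet (fun i y => (gradSq v y + δ) ^ (β/2) * pd i v y) x) * (φ x) ^ 2) K := by
    refine ContinuousOn.integrableOn_compact hKc ?_
    intro x hx
    have q := fun i j => ContDiffAt.continuousAt
      (Sm.pd (ContDiffAt.mul ((sv x hx).gsp hδ (β/2)) ((sv x hx).pd i)) j)
    have h1 : ContinuousAt (jdet (fun i y => (gradSq v y + δ) ^ (β/2) * pd i v y)) x :=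
      ((q 0 0).mul (q 1 1)).sub ((q 0 1).mul (q 1 0))
    exact (h1.neg.mul ((sφ x).continuousAt.pow 2)).continuousWithinAt
  have iR : IntegrableOn (fun x => (gradSq v x + δ) ^ (β+1)
            * (|φ x| * Real.sqrt (hessFrobSq φ x) + gradSq φ x)) K := by
    refine ContinuousOn.integrableOn_compact hKc ?_
    intro x hx
    have q := ((sv x hx).gsp hδ (β+1)).continuousAt
    have p := fun i => ((sφ x).pd i).continuousAt
    have pp := fun i j => (((sφ x).pd j).pd i).continuousAt
    have h1 : ContinuousAt (hessFrobSq φ) x :=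
      ((((pp 0 0).pow 2).add ((pp 0 1).pow 2)).add ((pp 1 0).pow 2)).add ((pp 1 1).pow 2)
    have h2 : ContinuousAt (gradSq φ) x := ((p 0).pow 2).add ((p 1).pow 2)
    exact (q.mul (((sφ x).continuousAt.abs.mul h1.sqrt).add h2)).continuousWithinAt
  have iD : IntegrableOn (fun x => pd 0 (Z0 v φ β δ) x + pd 1 (Z1 v φ β δ) x) K :=
    (i0.add i1).integrableOn
  have key := setIntegral_mono_on iL (iD.add (iR.const_mul (8 * ((1 + β^2)/(1 + β)))))
    hKcl.measurableSet
    (fun x hx => point (sv x hx) (sφ x) hδ hε hβ (heq x (hφU hx)))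
  refine key.trans (le_of_eq ?_)
  simp only [Pi.add_apply]
  rw [integral_add iD (iR.const_mul _), e, zero_add, integral_const_mul]
end
end

section
/- There exists an absolute constant C > 0 with the following property. Let Ω ⊆ ℝ² be open, v ∈ C^∞(Ω), a ∈ ℝ², and φ ∈ C_c^∞(Ω). Then ∫_Ω (−det D²v) φ² dx ≤ C ∫_Ω |Dv − a|² ( |φ| |D²φ| + |Dφ|² ) dx. -/
open Real MeasureTheory
open scoped RealInnerProductSpace

noncomputable section

lemma aux_pd_smooth {Ω : Set E2} (hΩ : IsOpen Ω) {f : E2 → ℝ}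
    (hf : ContDiffOn ℝ (⊤ : ℕ∞) f Ω) (i : Fin 2) : ContDiffOn ℝ (⊤ : ℕ∞) (pd i f) Ω := by
  have h := hf.fderiv_of_isOpen (m := ((⊤ : ℕ∞) : WithTop ℕ∞)) hΩ (by simp)
  exact h.clm_apply contDiffOn_const

lemma aux_diff {Ω : Set E2} (hΩ : IsOpen Ω) {f : E2 → ℝ}
    (hf : ContDiffOn ℝ (⊤ : ℕ∞) f Ω) {x : E2} (hx : x ∈ Ω) : DifferentiableAt ℝ f x :=
  (hf.contDiffAt (hΩ.mem_nhds hx)).differentiableAt (by simp)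

lemma aux_symm {Ω : Set E2} (hΩ : IsOpen Ω) {f : E2 → ℝ}
    (hf : ContDiffOn ℝ (⊤ : ℕ∞) f Ω) {x : E2} (hx : x ∈ Ω) (i j : Fin 2) :
    pd i (pd j f) x = pd j (pd i f) x := by
  have hc := hf.contDiffAt (hΩ.mem_nhds hx)
  have hs : IsSymmSndFDerivAt ℝ f x := hc.isSymmSndFDerivAt (by
    simp only [minSmoothness_of_isRCLikeNormedField]; exact WithTop.coe_le_coe.2 (le_top : (2 : ℕ∞) ≤ ⊤))
  have hd : DifferentiableAt ℝ (fderiv ℝ f) x :=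
    (hc.fderiv_right (m := 1) (by norm_cast)).differentiableAt (by simp)
  have key : ∀ i j : Fin 2, pd i (pd j f) x = fderiv ℝ (fderiv ℝ f) x (ee i) (ee j) := by
    intro i j
    have h1 : HasFDerivAt (pd j f) ((fderiv ℝ (fderiv ℝ f) x).flip (ee j)) x := by
      have := hd.hasFDerivAt.clm_apply (hasFDerivAt_const (ee j) x)
      rw [ContinuousLinearMap.comp_zero, zero_add] at this
      exact this
    show fderiv ℝ (pd j f) x (ee i) = _
    rw [h1.fderiv]; rfl
  rw [key, key]
  exact hs _ _

lemma aux_line {f : E2 → ℝ} {x : E2} (hf : DifferentiableAt ℝ f x) (i : Fin 2) :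
    HasDerivAt (fun t : ℝ => f (x + t • ee i)) (pd i f x) 0 :=
  hf.hasFDerivAt.hasLineDerivAt (ee i)

lemma aux_cont {Ω K : Set E2} (hΩ : IsOpen Ω) (hK : IsCompact K) (hKΩ : K ⊆ Ω) {F : E2 → ℝ}
    (hF : ContinuousOn F Ω) (h0 : ∀ x, x ∉ K → F x = 0) : Integrable F := by
  have hc : Continuous F := by
    rw [continuous_iff_continuousAt]
    intro x
    by_cases hx : x ∈ K
    · exact hF.continuousAt (hΩ.mem_nhds (hKΩ hx))
    · have : F =ᶠ[nhds x] fun _ => 0 := by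
        filter_upwards [hK.isClosed.isOpen_compl.mem_nhds hx] with y hy using h0 y hy
      exact continuousAt_const.congr this.symm
  exact hc.integrable_of_hasCompactSupport (HasCompactSupport.intro hK h0)

lemma aux_pd_zero {K : Set E2} (hK : IsCompact K) {F : E2 → ℝ}
    (h0 : ∀ x, x ∉ K → F x = 0) (i : Fin 2) : ∀ x, x ∉ K → pd i F x = 0 := by
  intro x hx
  have : F =ᶠ[nhds x] fun _ => 0 := by
    filter_upwards [hK.isClosed.isOpen_compl.mem_nhds hx] with y hy using h0 y hy
  unfold pd
  rw [this.fderiv_eq]; simp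

lemma aux_int {Ω K : Set E2} (hΩ : IsOpen Ω) (hK : IsCompact K) (hKΩ : K ⊆ Ω) {F : E2 → ℝ}
    (hF : ContDiffOn ℝ (⊤ : ℕ∞) F Ω) (h0 : ∀ x, x ∉ K → F x = 0) (i : Fin 2) :
    Integrable (pd i F) ∧ ∫ x, pd i F x = 0 := by
  have hI : Integrable (pd i F) :=
    aux_cont hΩ hK hKΩ (aux_pd_smooth hΩ hF i).continuousOn (aux_pd_zero hK h0 i)
  refine ⟨hI, ?_⟩
  have hd : Differentiable ℝ F := by
    intro x
    by_cases hx : x ∈ K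
    · exact aux_diff hΩ hF (hKΩ hx)
    · have : F =ᶠ[nhds x] fun _ => 0 := by
        filter_upwards [hK.isClosed.isOpen_compl.mem_nhds hx] with y hy using h0 y hy
      exact (differentiableAt_const (0:ℝ)).congr_of_eventuallyEq this
  have := integral_mul_fderiv_eq_neg_fderiv_mul_of_integrable (μ := volume)
    (f := fun _ : E2 => (1:ℝ)) (g := F) (v := ee i)
    (by simp) (by simp only [one_mul]; exact hI)
    (by simpa using aux_cont hΩ hK hKΩ hF.continuousOn h0) (fun x _ => by fun_prop)
    (fun x _ => hd x)
  simp only [one_mul, fderiv_fun_const, Pi.zero_apply, zero_mul,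
    integral_zero, neg_zero, ContinuousLinearMap.zero_apply] at this
  exact this

lemma aux_grad (v : E2 → ℝ) (a x : E2) :
    ‖gradient v x - a‖ ^ 2 = (pd 0 v x - a 0) ^ 2 + (pd 1 v x - a 1) ^ 2 := by
  have h : ∀ i, pd i v x = gradient v x i := by
    intro i
    have : pd i v x = inner ℝ (gradient v x) (ee i) := by
      unfold pd gradient
      rw [InnerProductSpace.toDual_symm_apply]
    rw [this]
    rw [ee, EuclideanSpace.inner_single_right]; simp
  rw [EuclideanSpace.norm_sq_eq, Fin.sum_univ_two, h, h]
  simp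

lemma aux_bound (p q f f0 f1 f00 f01 f10 f11 : ℝ) (hs : f01 = f10) :
    p ^ 2 * (f * f11 + f1 ^ 2) + q ^ 2 * (f * f00 + f0 ^ 2) - 2 * p * q * (f * f01 + f0 * f1)
      ≤ 2 * ((p ^ 2 + q ^ 2) *
        (|f| * Real.sqrt (f00 ^ 2 + f01 ^ 2 + f10 ^ 2 + f11 ^ 2) + (f0 ^ 2 + f1 ^ 2))) := by
  set H := Real.sqrt (f00 ^ 2 + f01 ^ 2 + f10 ^ 2 + f11 ^ 2) with hH
  have b : ∀ y : ℝ, y ^ 2 ≤ f00 ^ 2 + f01 ^ 2 + f10 ^ 2 + f11 ^ 2 → |f * y| ≤ |f| * H := by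
    intro y hy
    rw [abs_mul]
    exact mul_le_mul_of_nonneg_left (Real.abs_le_sqrt hy) (abs_nonneg f)
  have b11 := abs_le.1 (b f11 (by nlinarith [sq_nonneg f00, sq_nonneg f01, sq_nonneg f10]))
  have b00 := abs_le.1 (b f00 (by nlinarith [sq_nonneg f11, sq_nonneg f01, sq_nonneg f10]))
  have b01 := abs_le.1 (b f01 (by nlinarith [sq_nonneg f00, sq_nonneg f11, sq_nonneg f10]))
  have hM : 0 ≤ |f| * H := by positivity
  generalize |f| * H = M at *
  have e1 : p ^ 2 * (f * f11) ≤ p ^ 2 * M := mul_le_mul_of_nonneg_left b11.2 (sq_nonneg p)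
  have e2 : q ^ 2 * (f * f00) ≤ q ^ 2 * M := mul_le_mul_of_nonneg_left b00.2 (sq_nonneg q)
  have e3 : -(2 * p * q * (f * f01)) ≤ (p ^ 2 + q ^ 2) * M := by
    nlinarith [mul_nonneg (sq_nonneg (p + q)) (by linarith [b01.2] : 0 ≤ M - f * f01),
      mul_nonneg (sq_nonneg (p - q)) (by linarith [b01.1] : 0 ≤ M + f * f01)]
  nlinarith [sq_nonneg (p * f0 + q * f1), sq_nonneg (p * f0), sq_nonneg (p * f1),
    sq_nonneg (q * f0), sq_nonneg (q * f1)]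

/-- the key estimate in the proof of Proposition 2.8. -/
theorem stmt_17 : ∃ C : ℝ, 0 < C ∧
    ∀ (Ω : Set E2), IsOpen Ω → ∀ v : E2 → ℝ, ContDiffOn ℝ (⊤ : ℕ∞) v Ω →
    ∀ a : E2, ∀ φ : E2 → ℝ, IsTestOn φ Ω →
    (∫ x in Ω, (-detHess v x) * (φ x) ^ 2)
      ≤ C * ∫ x in Ω, ‖gradient v x - a‖ ^ 2
            * (|φ x| * Real.sqrt (hessFrobSq φ x) + gradSq φ x) := by
  refine ⟨2, by norm_num, ?_⟩
  intro Ω hΩ v hv a φ ⟨hφ, hcs, hsub⟩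
  have hK : IsCompact (tsupport φ) := hcs
  set K := tsupport φ with hKdef
  have z : ∀ x, x ∉ K → φ x = 0 := fun x hx => image_eq_zero_of_notMem_tsupport hx
  have zi := fun i => aux_pd_zero hK z i
  have hφ' : ContDiffOn ℝ (⊤ : ℕ∞) φ Ω := hφ.contDiffOn
  have sφ := fun i => aux_pd_smooth hΩ hφ' i
  have sφ2 := fun i j => aux_pd_smooth hΩ (sφ j) i
  have sv := fun i => aux_pd_smooth hΩ hv i
  have sv2 := fun i j => aux_pd_smooth hΩ (sv j) i
  have sp : ∀ i, ContDiffOn ℝ (⊤ : ℕ∞) (fun x => pd i v x - a i) Ω :=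
    fun i => (sv i).sub contDiffOn_const
  let A : E2 → ℝ := fun x => -((pd 1 v x - a 1) ^ 2 * (φ x * pd 0 φ x))
    + 2 * ((pd 0 v x - a 0) * (pd 1 v x - a 1)) * (φ x * pd 1 φ x)
    + (pd 1 v x - a 1) * pd 1 (pd 0 v) x * φ x ^ 2
  let B : E2 → ℝ := fun x => -((pd 0 v x - a 0) ^ 2 * (φ x * pd 1 φ x))
    - (pd 1 v x - a 1) * pd 0 (pd 0 v) x * φ x ^ 2
  let R : E2 → ℝ := fun x =>
    (pd 0 v x - a 0) ^ 2 * (φ x * pd2 1 1 φ x + pd 1 φ x ^ 2)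
    + (pd 1 v x - a 1) ^ 2 * (φ x * pd2 0 0 φ x + pd 0 φ x ^ 2)
    - 2 * (pd 0 v x - a 0) * (pd 1 v x - a 1) * (φ x * pd2 0 1 φ x + pd 0 φ x * pd 1 φ x)
  let G : E2 → ℝ := fun x => ‖gradient v x - a‖ ^ 2
            * (|φ x| * Real.sqrt (hessFrobSq φ x) + gradSq φ x)
  have hA : ContDiffOn ℝ (⊤ : ℕ∞) A Ω :=
    (((((sp 1).pow 2).mul (hφ'.mul (sφ 0))).neg).add
      ((contDiffOn_const.mul ((sp 0).mul (sp 1))).mul (hφ'.mul (sφ 1)))).add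
      (((sp 1).mul (sv2 1 0)).mul (hφ'.pow 2))
  have hB : ContDiffOn ℝ (⊤ : ℕ∞) B Ω :=
    ((((sp 0).pow 2).mul (hφ'.mul (sφ 1))).neg).sub
      (((sp 1).mul (sv2 0 0)).mul (hφ'.pow 2))
  have hA0 : ∀ x, x ∉ K → A x = 0 := by intro x hx; simp [A, z x hx]
  have hB0 : ∀ x, x ∉ K → B x = 0 := by intro x hx; simp [B, z x hx]
  have hR0 : ∀ x, x ∉ K → R x = 0 := by intro x hx; simp [R, z x hx, zi _ x hx]
  have hG0 : ∀ x, x ∉ K → G x = 0 := by intro x hx; simp [G, gradSq, z x hx, zi _ x hx]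
  have hRi : Integrable R := by
    refine aux_cont hΩ hK hsub ?_ hR0
    have c0 := hφ'.continuousOn
    have c1 := fun i => (sφ i).continuousOn
    have c2 : ∀ i j, ContinuousOn (pd2 i j φ) Ω := fun i j => (sφ2 i j).continuousOn
    have c3 := fun i => (sp i).continuousOn
    exact ((((c3 0).pow 2).mul ((c0.mul (c2 1 1)).add ((c1 1).pow 2))).add
      (((c3 1).pow 2).mul ((c0.mul (c2 0 0)).add ((c1 0).pow 2)))).sub
      (((continuousOn_const.mul (c3 0)).mul (c3 1)).mul
        ((c0.mul (c2 0 1)).add ((c1 0).mul (c1 1))))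
  have hGi : Integrable G := by
    refine aux_cont hΩ hK hsub ?_ hG0
    have c0 := hφ'.continuousOn
    have c1 := fun i => (sφ i).continuousOn
    have c2 : ∀ i j, ContinuousOn (pd2 i j φ) Ω := fun i j => (sφ2 i j).continuousOn
    have c3 := fun i => (sp i).continuousOn
    simp only [G, aux_grad]
    exact (((c3 0).pow 2).add ((c3 1).pow 2)).mul ((c0.abs.mul
      ((((((c2 0 0).pow 2).add ((c2 0 1).pow 2)).add ((c2 1 0).pow 2)).add
        ((c2 1 1).pow 2)).sqrt)).add (((c1 0).pow 2).add ((c1 1).pow 2)))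
  obtain ⟨hAi, hAz⟩ := aux_int hΩ hK hsub hA hA0 0
  obtain ⟨hBi, hBz⟩ := aux_int hΩ hK hsub hB hB0 1
  have key : ∀ x, (-detHess v x) * (φ x) ^ 2 = R x + (pd 0 A x + pd 1 B x) := by
    intro x
    by_cases hx : x ∈ K
    swap
    · rw [hR0 x hx, aux_pd_zero hK hA0 0 x hx, aux_pd_zero hK hB0 1 x hx, z x hx]; simp
    have hx' := hsub hx
    have lφ := fun i => aux_line (aux_diff hΩ hφ' hx') i
    have lφ1 := fun i j => aux_line (aux_diff hΩ (sφ j) hx') i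
    have lv := fun i j => (aux_line (aux_diff hΩ (sv j) hx') i).sub_const (a j)
    have lv2 := fun i j k => aux_line (aux_diff hΩ (sv2 j k) hx') i
    have dA := ((((((lv 0 1).pow 2).mul ((lφ 0).mul (lφ1 0 0))).neg).add
      ((((lv 0 0).mul (lv 0 1)).const_mul 2).mul ((lφ 0).mul (lφ1 0 1)))).add
      (((lv 0 1).mul (lv2 0 1 0)).mul ((lφ 0).pow 2))).unique
        (aux_line (aux_diff hΩ hA hx') 0)
    have dB := (((((lv 1 0).pow 2).mul ((lφ 1).mul (lφ1 1 1))).neg).sub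
      (((lv 1 1).mul (lv2 1 0 0)).mul ((lφ 1).pow 2))).unique
        (aux_line (aux_diff hΩ hB hx') 1)
    have s1 := aux_symm hΩ hv hx' 0 1
    have s2 := aux_symm hΩ hφ' hx' 1 0
    have s3 := aux_symm hΩ (sv 0) hx' 1 0
    rw [← dA, ← dB]
    simp only [R, detHess, pd2, s1, s2, s3, zero_smul, add_zero, Pi.mul_apply, Pi.pow_apply]
    norm_num
    ring
  have hle : ∀ x, R x ≤ 2 * G x := by
    intro x
    by_cases hx : x ∈ K
    swap
    · rw [hR0 x hx, hG0 x hx]; simp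
    have s2 := aux_symm hΩ hφ' (hsub hx) 0 1
    simp only [R, G, aux_grad, hessFrobSq, gradSq]
    exact aux_bound _ _ _ _ _ _ _ _ _ s2
  rw [setIntegral_eq_integral_of_forall_compl_eq_zero
      (fun x hx => by simp [z x (fun h => hx (hsub h))]),
    setIntegral_eq_integral_of_forall_compl_eq_zero
      (fun x hx => hG0 x (fun h => hx (hsub h)))]
  calc ∫ x, (-detHess v x) * (φ x) ^ 2 = ∫ x, (R x + (pd 0 A x + pd 1 B x)) :=
        integral_congr_ae (Filter.Eventually.of_forall key)
    _ = ∫ x, R x := by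
        
        have h1 : Integrable (fun x => pd 0 A x + pd 1 B x) := hAi.add hBi
        rw [integral_add hRi h1, integral_add hAi hBi, hAz, hBz]; simp
    _ ≤ ∫ x, 2 * G x := integral_mono hRi (hGi.const_mul 2) hle
    _ = 2 * ∫ x, G x := integral_const_mul _ _
end
end
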